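/- Suppose m distinct points x_1,…,x_m ∈ ℝ^s and Y = [y_j^k] ∈ ℝ^{t×m} are given, λ > 0, and the loss function Q : ℝ^{t×m} → [0,∞) is lower semi-continuous. If D_{X,Y} ≠ {0}, then there exists a solution f̂ of the regularization problem inf{Q(I_X(f_μ) − Y) + λ‖f_μ‖_{B_N} : f_μ ∈ B_N} such that f̂(x) = Σ_{ℓ=1}^{tm} γ_ℓ h_ℓ(x) for all x ∈ ℝ^s, for some nonzero ĝ ∈ V_N, some γ_1,…,γ_{tm} ∈ ℝ with Σ_{ℓ=1}^{tm} γ_ℓ = ‖ĝ‖_∞, and some h_1,…,h_{tm} ∈ ext(∂‖·‖_∞(ĝ)). -/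

import Mathlib

open MeasureTheory Filter Topology
open scoped ZeroAtInfty BigOperators

noncomputable section

/-- The parameter space of a depth-`D` deep neural network with layer widths
`m 0, m 1, …, m D` (input dimension `m 0 = s`, output dimension `m D = t`). -/
abbrev Params (m : ℕ → ℕ) (D : ℕ) : Type :=
  (j : Fin D) → ((Fin (m (j.1 + 1)) → Fin (m j.1) → ℝ) × (Fin (m (j.1 + 1)) → ℝ))

/-- The deep neural network `N(x, θ)` of depth `D`, defined recursively by
`N¹(x) = W₁ x + b₁` and `N^{j+1}(x) = W_{j+1} σ(N^j(x)) + b_{j+1}`. -/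
def NNet (σ : ℝ → ℝ) (m : ℕ → ℕ) :
    (D : ℕ) → Params m D → (Fin (m 0) → ℝ) → Fin (m D) → ℝ
  | 0, _, x => x
  | 1, θ, x => fun i => (∑ k, (θ ⟨0, Nat.one_pos⟩).1 i k * x k) + (θ ⟨0, Nat.one_pos⟩).2 i
  | (D + 2), θ, x => fun i =>
      (∑ k, (θ (Fin.last (D + 1))).1 i k *
          σ (NNet σ m (D + 1) (fun j => θ j.castSucc) x k))
        + (θ (Fin.last (D + 1))).2 i

/-- The integral of a function against a finite signed (Radon) measure,
via the Jordan decomposition. -/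
def sInt {Θ : Type*} [MeasurableSpace Θ] (μ : SignedMeasure Θ) (f : Θ → ℝ) : ℝ :=
  (∫ θ, f θ ∂μ.toJordanDecomposition.posPart) - ∫ θ, f θ ∂μ.toJordanDecomposition.negPart

/-- The total variation norm of a signed measure. -/
def tvNorm {Θ : Type*} [MeasurableSpace Θ] (μ : SignedMeasure Θ) : ℝ :=
  (μ.totalVariation Set.univ).toReal

/-- `f_μ^k(x) := ∫_Θ N_k(x,θ) ρ(θ) dμ(θ)`. -/
def fMu (σ : ℝ → ℝ) (m : ℕ → ℕ) (D : ℕ) (ρ : Params m D → ℝ)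
    (μ : SignedMeasure (Params m D)) : (Fin (m 0) → ℝ) → Fin (m D) → ℝ :=
  fun x k => sInt μ fun θ => NNet σ m D θ x k * ρ θ

/-- The set `B_N = {f_μ : μ ∈ M(Θ)}`. -/
def BNset (σ : ℝ → ℝ) (m : ℕ → ℕ) (D : ℕ) (ρ : Params m D → ℝ) :
    Set ((Fin (m 0) → ℝ) → Fin (m D) → ℝ) :=
  {f | ∃ μ : SignedMeasure (Params m D), fMu σ m D ρ μ = f}

/-- The norm `‖f‖_{B_N} = inf {‖ν‖_TV : f_ν = f}`. -/
def BNnorm (σ : ℝ → ℝ) (m : ℕ → ℕ) (D : ℕ) (ρ : Params m D → ℝ)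
    (f : (Fin (m 0) → ℝ) → Fin (m D) → ℝ) : ℝ :=
  sInf (tvNorm '' {ν : SignedMeasure (Params m D) | fMu σ m D ρ ν = f})

/-- `S`: the closed linear span in `C₀(Θ)` of the functions `θ ↦ N_k(x,θ)ρ(θ)`
(given here as the bundled family `Kb`). -/
def Sspan (m : ℕ → ℕ) (D : ℕ)
    (Kb : (Fin (m 0) → ℝ) → Fin (m D) → C₀(Params m D, ℝ)) :
    Submodule ℝ C₀(Params m D, ℝ) :=
  (Submodule.span ℝ
    (Set.range fun p : (Fin (m 0) → ℝ) × Fin (m D) => Kb p.1 p.2)).topologicalClosure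

/-- `V_N := span {K_k(x_j, ·) : j, k}`. -/
def VN (m : ℕ → ℕ) (D : ℕ)
    (Kb : (Fin (m 0) → ℝ) → Fin (m D) → C₀(Params m D, ℝ))
    (M : ℕ) (x : Fin M → (Fin (m 0) → ℝ)) : Submodule ℝ C₀(Params m D, ℝ) :=
  Submodule.span ℝ (Set.range fun p : Fin (m D) × Fin M => Kb (x p.2) p.1)

/-- The interpolation condition `f(x_j) = y_j`, i.e. `f_k(x_j) = y_j^k` for all `j, k`. -/
def interpolates (m : ℕ → ℕ) (D : ℕ) (M : ℕ) (x : Fin M → (Fin (m 0) → ℝ))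
    (Y : Fin (m D) → Fin M → ℝ) (f : (Fin (m 0) → ℝ) → Fin (m D) → ℝ) : Prop :=
  ∀ (j : Fin M) (k : Fin (m D)), f (x j) k = Y k j

/-- The solution set `S_{X,Y}` of the MNI problem
`inf {‖f‖_{B_N} : f ∈ B_N, f(x_j) = y_j}`. -/
def MNISolSet (σ : ℝ → ℝ) (m : ℕ → ℕ) (D : ℕ) (ρ : Params m D → ℝ)
    (M : ℕ) (x : Fin M → (Fin (m 0) → ℝ)) (Y : Fin (m D) → Fin M → ℝ) :
    Set ((Fin (m 0) → ℝ) → Fin (m D) → ℝ) :=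
  {f | f ∈ BNset σ m D ρ ∧ interpolates m D M x Y f ∧
    ∀ μ : SignedMeasure (Params m D), interpolates m D M x Y (fMu σ m D ρ μ) →
      BNnorm σ m D ρ f ≤ BNnorm σ m D ρ (fMu σ m D ρ μ)}

/-- The solution set of the measure MNI problem
`inf {‖μ‖_TV : μ ∈ M(Θ), ∫ K_k(x_j,·) dμ = y_j^k}`. -/
def MeasSolSet (σ : ℝ → ℝ) (m : ℕ → ℕ) (D : ℕ) (ρ : Params m D → ℝ)
    (M : ℕ) (x : Fin M → (Fin (m 0) → ℝ)) (Y : Fin (m D) → Fin M → ℝ) :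
    Set (SignedMeasure (Params m D)) :=
  {μ | interpolates m D M x Y (fMu σ m D ρ μ) ∧
    ∀ ν : SignedMeasure (Params m D), interpolates m D M x Y (fMu σ m D ρ ν) →
      tvNorm μ ≤ tvNorm ν}

/-- The subdifferential `∂‖·‖_∞(g) ⊆ B_N` of the supremum norm at `g ∈ S`, viewing `B_N`
as the dual of `S` via the (representation independent) pairing `⟨f_μ, g⟩ = ∫ g dμ`:
`∂‖·‖_∞(g) = {f_μ ∈ B_N : ‖f_μ‖_{B_N} = 1, ∫ g dμ = ‖g‖_∞}`. -/
def subdiffSup (σ : ℝ → ℝ) (m : ℕ → ℕ) (D : ℕ) (ρ : Params m D → ℝ)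
    (g : C₀(Params m D, ℝ)) : Set ((Fin (m 0) → ℝ) → Fin (m D) → ℝ) :=
  {f | f ∈ BNset σ m D ρ ∧ BNnorm σ m D ρ f = 1 ∧
    ∀ μ : SignedMeasure (Params m D), fMu σ m D ρ μ = f → sInt μ (fun θ => g θ) = ‖g‖}

/-- Feasibility for the dual problem: `‖∑_{k,j} c_{kj} K_k(x_j,·)‖_∞ = 1`. -/
def dualFeasible (m : ℕ → ℕ) (D : ℕ)
    (Kb : (Fin (m 0) → ℝ) → Fin (m D) → C₀(Params m D, ℝ))
    (M : ℕ) (x : Fin M → (Fin (m 0) → ℝ)) (c : Fin (m D) → Fin M → ℝ) : Prop :=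
  ‖∑ k, ∑ j, c k j • Kb (x j) k‖ = 1

/-- The objective `∑_{k,j} c_{kj} y_j^k` of the dual problem. -/
def dualObjective (m : ℕ → ℕ) (D : ℕ) (M : ℕ) (Y : Fin (m D) → Fin M → ℝ)
    (c : Fin (m D) → Fin M → ℝ) : ℝ :=
  ∑ k, ∑ j, c k j * Y k j

/-- `c` is a solution of the dual problem. -/
def dualSolves (m : ℕ → ℕ) (D : ℕ)
    (Kb : (Fin (m 0) → ℝ) → Fin (m D) → C₀(Params m D, ℝ))
    (M : ℕ) (x : Fin M → (Fin (m 0) → ℝ)) (Y : Fin (m D) → Fin M → ℝ)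
    (c : Fin (m D) → Fin M → ℝ) : Prop :=
  dualFeasible m D Kb M x c ∧
    ∀ c' : Fin (m D) → Fin M → ℝ, dualFeasible m D Kb M x c' →
      dualObjective m D M Y c' ≤ dualObjective m D M Y c

/-- `ĝ := C* · ∑_{k,j} ĉ_{kj} K_k(x_j,·)`, where `C*` is the optimal dual value
(the value of the dual objective at the dual solution `c`). -/
def ghat (m : ℕ → ℕ) (D : ℕ)
    (Kb : (Fin (m 0) → ℝ) → Fin (m D) → C₀(Params m D, ℝ))
    (M : ℕ) (x : Fin M → (Fin (m 0) → ℝ)) (Y : Fin (m D) → Fin M → ℝ)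
    (c : Fin (m D) → Fin M → ℝ) : C₀(Params m D, ℝ) :=
  dualObjective m D M Y c • ∑ k, ∑ j, c k j • Kb (x j) k

/-- `Θ(g) := {θ ∈ Θ : |g(θ)| = ‖g‖_∞}`. -/
def ThetaSet (m : ℕ → ℕ) (D : ℕ) (g : C₀(Params m D, ℝ)) : Set (Params m D) :=
  {θ | |g θ| = ‖g‖}

/-- The regularization objective `Q(I_X(f) − Y) + λ ‖f‖_{B_N}`. -/
def regObj (σ : ℝ → ℝ) (m : ℕ → ℕ) (D : ℕ) (ρ : Params m D → ℝ)
    (M : ℕ) (x : Fin M → (Fin (m 0) → ℝ)) (Y : Fin (m D) → Fin M → ℝ)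
    (lam : ℝ) (Q : (Fin (m D) → Fin M → ℝ) → ℝ)
    (f : (Fin (m 0) → ℝ) → Fin (m D) → ℝ) : ℝ :=
  Q ((fun k j => f (x j) k) - Y) + lam * BNnorm σ m D ρ f

/-- The solution set `R_{X,Y}` of the regularization problem. -/
def RegSolSet (σ : ℝ → ℝ) (m : ℕ → ℕ) (D : ℕ) (ρ : Params m D → ℝ)
    (M : ℕ) (x : Fin M → (Fin (m 0) → ℝ)) (Y : Fin (m D) → Fin M → ℝ)
    (lam : ℝ) (Q : (Fin (m D) → Fin M → ℝ) → ℝ) :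
    Set ((Fin (m 0) → ℝ) → Fin (m D) → ℝ) :=
  {f | f ∈ BNset σ m D ρ ∧
    ∀ μ : SignedMeasure (Params m D),
      regObj σ m D ρ M x Y lam Q f ≤ regObj σ m D ρ M x Y lam Q (fMu σ m D ρ μ)}

/-- `D_{X,Y} := I_X(R_{X,Y})`. -/
def DXY (σ : ℝ → ℝ) (m : ℕ → ℕ) (D : ℕ) (ρ : Params m D → ℝ)
    (M : ℕ) (x : Fin M → (Fin (m 0) → ℝ)) (Y : Fin (m D) → Fin M → ℝ)
    (lam : ℝ) (Q : (Fin (m D) → Fin M → ℝ) → ℝ) : Set (Fin (m D) → Fin M → ℝ) :=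
  (fun f => fun k j => f (x j) k) '' RegSolSet σ m D ρ M x Y lam Q

/-- A convex combination can be padded with zero weights to any larger number of points. -/
lemma exists_fin_convex_combination {ι F : Type*} [Fintype ι] [AddCommGroup F] [Module ℝ F]
    {s : Set F} {N : ℕ} (hN : Fintype.card ι ≤ N) {z : ι → F} {w : ι → ℝ}
    (hz : ∀ i, z i ∈ s) (hw : ∀ i, 0 ≤ w i) (hw1 : ∑ i, w i = 1) :
    ∃ (c : Fin N → ℝ) (p : Fin N → F), c ∈ stdSimplex ℝ (Fin N) ∧ (∀ i, p i ∈ s) ∧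
      ∑ i, c i • p i = ∑ i, w i • z i := by
  obtain ⟨e⟩ : Nonempty (ι ↪ Fin N) := Function.Embedding.nonempty_of_card_le (by simpa using hN)
  obtain ⟨i₀⟩ : Nonempty ι := by
    by_contra h
    rw [not_nonempty_iff] at h
    simp at hw1
  have hc : ∀ i, Function.extend e w 0 (e i) = w i := e.injective.extend_apply w 0
  have hp : ∀ i, Function.extend e z (fun _ => z i₀) (e i) = z i := e.injective.extend_apply z _
  have hc0 : ∀ j, j ∉ Set.range e → Function.extend e w 0 j = 0 := fun j hj =>
    Function.extend_apply' _ _ _ hj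
  refine ⟨Function.extend e w 0, Function.extend e z (fun _ => z i₀), ⟨fun j => ?_, ?_⟩,
    fun j => ?_, ?_⟩
  · by_cases hj : j ∈ Set.range e
    · obtain ⟨i, rfl⟩ := hj
      rw [hc]
      exact hw i
    · rw [hc0 j hj]
  · rw [← hw1]
    exact (Fintype.sum_of_injective e e.injective _ _ hc0 fun i => (hc i).symm).symm
  · by_cases hj : j ∈ Set.range e
    · obtain ⟨i, rfl⟩ := hj
      rw [hp]
      exact hz i
    · rw [Function.extend_apply' _ _ _ hj]
      exact hz i₀
  · refine (Fintype.sum_of_injective e e.injective _ _ (fun j hj => ?_) fun i => ?_).symm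
    · rw [hc0 j hj, zero_smul]
    · rw [hc, hp]

/-- **Carathéodory's theorem** with a fixed number of points. -/
lemma exists_fin_of_mem_convexHull {F : Type*} [AddCommGroup F] [Module ℝ F]
    [FiniteDimensional ℝ F] {s : Set F} {x : F} (hx : x ∈ convexHull ℝ s) :
    ∃ (c : Fin (Module.finrank ℝ F + 1) → ℝ) (p : Fin (Module.finrank ℝ F + 1) → F),
      c ∈ stdSimplex ℝ _ ∧ (∀ i, p i ∈ s) ∧ ∑ i, c i • p i = x := by
  obtain ⟨ι, _, z, w, hz, hzi, hw, hw1, rfl⟩ := eq_pos_convex_span_of_mem_convexHull hx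
  exact exists_fin_convex_combination
    (hzi.card_le_finrank_succ.trans (Nat.add_le_add_right (Submodule.finrank_le _) 1))
    (fun i => hz ⟨i, rfl⟩) (fun i => (hw i).le) hw1

/-- **Carathéodory's theorem** for a set lying in a hyperplane that avoids the origin. -/
lemma exists_fin_of_mem_convexHull_of_subset_hyperplane {F : Type*} [AddCommGroup F] [Module ℝ F]
    [FiniteDimensional ℝ F] {s : Set F} {x : F} (hx : x ∈ convexHull ℝ s) (P : F →ₗ[ℝ] ℝ)
    {r : ℝ} (hr : r ≠ 0) (hs : ∀ y ∈ s, P y = r) {N : ℕ} (hN : Module.finrank ℝ F ≤ N) :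
    ∃ (c : Fin N → ℝ) (p : Fin N → F),
      c ∈ stdSimplex ℝ _ ∧ (∀ i, p i ∈ s) ∧ ∑ i, c i • p i = x := by
  obtain ⟨ι, _, z, w, hz, hzi, hw, hw1, rfl⟩ := eq_pos_convex_span_of_mem_convexHull hx
  have hli : LinearIndependent ℝ z := by
    rw [Fintype.linearIndependent_iff]
    intro a ha i
    refine affineIndependent_iff.1 hzi Finset.univ a ?_ ha i (Finset.mem_univ i)
    have h := congrArg P ha
    simp only [map_sum, map_smul, map_zero, hs _ (hz ⟨_, rfl⟩), smul_eq_mul,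
      ← Finset.sum_mul] at h
    exact (mul_eq_zero.1 h).resolve_right hr
  exact exists_fin_convex_combination (hli.fintype_card_le_finrank.trans hN)
    (fun i => hz ⟨i, rfl⟩) (fun i => (hw i).le) hw1

/-- **Minkowski's theorem**: a point of a compact convex set in a finite-dimensional space is a
convex combination of extreme points. -/
lemma mem_convexHull_extremePoints {E : Type*} [AddCommGroup E] [Module ℝ E] [TopologicalSpace E]
    [T2Space E] [IsTopologicalAddGroup E] [ContinuousSMul ℝ E] [FiniteDimensional ℝ E]
    {φ : E → ℝ} (hφ : Continuous φ) (hφs : StrictConvexOn ℝ Set.univ φ)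
    {K : Set E} (hK : IsCompact K) {w : E} (hw : w ∈ K) :
    w ∈ convexHull ℝ (K.extremePoints ℝ) := by
  set N := Module.finrank ℝ (E × ℝ) + 1
  let T : Set ((Fin N → ℝ) × (Fin N → E)) :=
    (stdSimplex ℝ (Fin N) ×ˢ Set.univ.pi fun _ => K) ∩ {q | ∑ i, q.1 i • q.2 i = w}
  have hT : IsCompact T :=
    ((isCompact_stdSimplex ℝ _).prod (isCompact_univ_pi fun _ => hK)).inter_right
      (isClosed_eq (by fun_prop) continuous_const)
  have hTne : T.Nonempty :=
    ⟨(Pi.single 0 1, fun _ => w), ⟨single_mem_stdSimplex ℝ 0, fun _ _ => hw⟩, by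
      simp [← Finset.sum_smul]⟩
  obtain ⟨⟨c, p⟩, ⟨⟨hc, hp⟩, hcp⟩, hmax⟩ := hT.exists_isMaxOn hTne
    (f := fun q => ∑ i, q.1 i * φ (q.2 i)) (by fun_prop)
  simp only [Set.mem_ofPred_eq] at hcp
  have hext : ∀ i, 0 < c i → p i ∈ K.extremePoints ℝ := by
    intro i hi
    refine ⟨hp i trivial, fun a ha b hb hab => ?_⟩
    by_contra hne
    have hab' : a ≠ b := by
      rintro rfl
      rw [openSegment_same, Set.mem_singleton_iff] at hab
      exact hne hab.symm
    obtain ⟨s, t, hs, ht, hst, hpi⟩ := hab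
    have hlt : φ (p i) < s * φ a + t * φ b := by
      rw [← hpi]
      exact hφs.2 trivial trivial hab' hs ht hst
    let G : Set (E × ℝ) := (fun q => (q, φ q)) '' K
    let y : Fin N → E × ℝ :=
      Function.update (fun j => (p j, φ (p j))) i (p i, s * φ a + t * φ b)
    have hyG : ∀ j, y j ∈ convexHull ℝ G := by
      intro j
      by_cases hj : j = i
      · subst hj
        have : y j = s • (a, φ a) + t • (b, φ b) := by simp [y, ← hpi]
        rw [this]
        exact convex_convexHull ℝ G (subset_convexHull ℝ G ⟨a, ha, rfl⟩)
          (subset_convexHull ℝ G ⟨b, hb, rfl⟩) hs.le ht.le hst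
      · simp only [y, Function.update_of_ne hj]
        exact subset_convexHull ℝ G ⟨p j, hp j trivial, rfl⟩
    have hmem : ∑ j, c j • y j ∈ convexHull ℝ G :=
      (convex_convexHull ℝ G).sum_mem (fun j _ => hc.1 j) hc.2 fun j _ => hyG j
    obtain ⟨c', q, hc', hq, hsum⟩ := exists_fin_of_mem_convexHull hmem
    choose p' hp' hqp using hq
    have h1 : ∑ j, c' j • p' j = w := by
      have := congrArg Prod.fst hsum
      simp only [Prod.fst_sum, Prod.smul_fst, ← hqp] at this
      rw [this, ← hcp]
      refine Finset.sum_congr rfl fun j _ => ?_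
      by_cases hj : j = i
      · subst hj; simp [y]
      · simp [y, hj]
    have h2 : ∑ j, c' j * φ (p' j) = ∑ j, c j * (y j).2 := by
      have := congrArg Prod.snd hsum
      simpa only [Prod.snd_sum, Prod.smul_snd, ← hqp, smul_eq_mul] using this
    have h3 : ∑ j, c j * φ (p j) < ∑ j, c j * (y j).2 := by
      refine Finset.sum_lt_sum (fun j _ => ?_) ⟨i, Finset.mem_univ i, ?_⟩
      · by_cases hj : j = i
        · subst hj
          simp only [y, Function.update_self]
          exact mul_le_mul_of_nonneg_left hlt.le hi.le
        · simp [y, hj]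
      · simp only [y, Function.update_self]
        exact mul_lt_mul_of_pos_left hlt hi
    have := hmax (show (c', p') ∈ T from ⟨⟨hc', fun j _ => hp' j⟩, h1⟩)
    simp only [Set.mem_ofPred_eq] at this
    linarith
  rw [← hcp, ← Finset.sum_filter_of_ne (p := fun i => 0 < c i)]
  · refine (convex_convexHull ℝ _).sum_mem (fun i _ => hc.1 i) ?_ fun i hi =>
      subset_convexHull ℝ _ (hext i (Finset.mem_filter.1 hi).2)
    rw [Finset.sum_filter_of_ne, hc.2]
    exact fun i _ hi => (hc.1 i).lt_of_ne' hi
  · intro i _ hi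
    exact (hc.1 i).lt_of_ne' fun h => hi (by rw [show c i = 0 from h, zero_smul])

lemma strictConvexOn_sum_sum_sq (α β : Type*) [Fintype α] [Fintype β] :
    StrictConvexOn ℝ Set.univ fun z : α → β → ℝ => ∑ k, ∑ j, z k j ^ 2 := by
  refine ⟨convex_univ, fun a _ b _ hab s t hs ht hst => ?_⟩
  have key : ∀ k j, (s • a + t • b) k j ^ 2 + s * t * (a k j - b k j) ^ 2
      = s * a k j ^ 2 + t * b k j ^ 2 := by
    intro k j
    obtain rfl : t = 1 - s := by linarith
    simp only [Pi.add_apply, Pi.smul_apply, smul_eq_mul]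
    ring
  have hpos : 0 < ∑ k, ∑ j, s * t * (a k j - b k j) ^ 2 := by
    obtain ⟨k, hk⟩ := Function.ne_iff.1 hab
    obtain ⟨j, hj⟩ := Function.ne_iff.1 hk
    have h0 : ∀ k j, 0 ≤ s * t * (a k j - b k j) ^ 2 := fun k j => by positivity
    refine Finset.sum_pos' (fun k _ => Finset.sum_nonneg fun j _ => h0 k j)
      ⟨k, Finset.mem_univ k, Finset.sum_pos' (fun j _ => h0 k j) ⟨j, Finset.mem_univ j, ?_⟩⟩
    have : a k j - b k j ≠ 0 := sub_ne_zero.2 hj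
    positivity
  have h := Finset.sum_congr (rfl : (Finset.univ : Finset α) = _) fun k _ =>
    Finset.sum_congr (rfl : (Finset.univ : Finset β) = _) fun j _ => key k j
  simp only [Finset.sum_add_distrib, ← Finset.mul_sum] at h hpos
  simp only [smul_eq_mul]
  linarith

section SignedMeasures

variable {Θ : Type*} [MeasurableSpace Θ]

lemma tvNorm_nonneg (μ : SignedMeasure Θ) : 0 ≤ tvNorm μ := ENNReal.toReal_nonneg

lemma tvNorm_eq (μ : SignedMeasure Θ) :
    tvNorm μ = μ.toJordanDecomposition.posPart.real Set.univ
      + μ.toJordanDecomposition.negPart.real Set.univ := by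
  rw [tvNorm, SignedMeasure.totalVariation, ← measureReal_def, measureReal_add_apply]

lemma ZeroAtInftyContinuousMap.norm_le_of_abs_apply_le {X : Type*} [TopologicalSpace X]
    (f : C₀(X, ℝ)) {r : ℝ} (hr : 0 ≤ r) (h : ∀ θ, |f θ| ≤ r) : ‖f‖ ≤ r := by
  rw [← ZeroAtInftyContinuousMap.norm_toBCF_eq_norm]
  exact (BoundedContinuousFunction.norm_le hr).2 h

variable [TopologicalSpace Θ] [BorelSpace Θ]

lemma ZeroAtInftyContinuousMap.integrable (f : C₀(Θ, ℝ)) (μ : Measure Θ) [IsFiniteMeasure μ] :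
    Integrable f μ :=
  f.toBCF.integrable μ

lemma ZeroAtInftyContinuousMap.abs_integral_le (f : C₀(Θ, ℝ)) (μ : Measure Θ)
    [IsFiniteMeasure μ] : |∫ θ, f θ ∂μ| ≤ μ.real Set.univ * ‖f‖ := by
  have := f.toBCF.norm_integral_le_mul_norm μ
  rwa [ZeroAtInftyContinuousMap.norm_toBCF_eq_norm] at this

lemma sInt_add (μ : SignedMeasure Θ) (f g : C₀(Θ, ℝ)) :
    sInt μ (f + g : C₀(Θ, ℝ)) = sInt μ f + sInt μ g := by
  simp only [sInt, ZeroAtInftyContinuousMap.add_apply]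
  rw [integral_add (f.integrable _) (g.integrable _),
    integral_add (f.integrable _) (g.integrable _)]
  ring

omit [BorelSpace Θ] in
lemma sInt_smul (μ : SignedMeasure Θ) (c : ℝ) (f : C₀(Θ, ℝ)) :
    sInt μ (c • f : C₀(Θ, ℝ)) = c * sInt μ f := by
  simp only [sInt, ZeroAtInftyContinuousMap.smul_apply, smul_eq_mul, integral_const_mul]
  ring

/-- Integration against a signed measure, as a linear functional on `C₀(Θ, ℝ)`. -/
def sIntLinear (μ : SignedMeasure Θ) : C₀(Θ, ℝ) →ₗ[ℝ] ℝ where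
  toFun f := sInt μ f
  map_add' := sInt_add μ
  map_smul' := sInt_smul μ

lemma abs_sInt_le (μ : SignedMeasure Θ) (f : C₀(Θ, ℝ)) : |sInt μ f| ≤ tvNorm μ * ‖f‖ := by
  rw [tvNorm_eq, add_mul]
  exact (abs_sub _ _).trans (add_le_add (f.abs_integral_le _) (f.abs_integral_le _))

/-- The difference of two finite measures as a signed measure. -/
lemma exists_signedMeasure_sub (p n : Measure Θ) [IsFiniteMeasure p] [IsFiniteMeasure n] :
    ∃ s : SignedMeasure Θ, tvNorm s ≤ p.real Set.univ + n.real Set.univ ∧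
      ∀ f : C₀(Θ, ℝ), sInt s f = (∫ θ, f θ ∂p) - ∫ θ, f θ ∂n := by
  have hsum : p + (n - p) = n + (p - n) := by
    rw [← Measure.toSignedMeasure_eq_toSignedMeasure_iff, Measure.toSignedMeasure_add,
      Measure.toSignedMeasure_add]
    have := Measure.sub_toSignedMeasure_eq_toSignedMeasure_sub (μ := p) (ν := n)
    rw [sub_eq_sub_iff_add_eq_add] at this
    rw [this, add_comm]
  refine ⟨p.toSignedMeasure - n.toSignedMeasure, ?_, fun f => ?_⟩
  · rw [tvNorm_eq, Measure.toJordanDecomposition_toSignedMeasure_sub]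
    refine add_le_add ?_ ?_
    · exact ENNReal.toReal_mono (measure_ne_top _ _) (Measure.sub_le _)
    · exact ENNReal.toReal_mono (measure_ne_top _ _) (Measure.sub_le _)
  · rw [sInt, Measure.toJordanDecomposition_toSignedMeasure_sub,
      Measure.jordanDecompositionOfToSignedMeasureSub_posPart,
      Measure.jordanDecompositionOfToSignedMeasureSub_negPart]
    have := congrArg (fun μ : Measure Θ => ∫ θ, f θ ∂μ) hsum
    rw [integral_add_measure (f.integrable _) (f.integrable _),
      integral_add_measure (f.integrable _) (f.integrable _)] at this
    linarith

/-- Nonnegative combinations of signed measures. -/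
lemma exists_signedMeasure_combination (μ ν : SignedMeasure Θ) {a b : ℝ} (ha : 0 ≤ a)
    (hb : 0 ≤ b) :
    ∃ s : SignedMeasure Θ, tvNorm s ≤ a * tvNorm μ + b * tvNorm ν ∧
      ∀ f : C₀(Θ, ℝ), sInt s f = a * sInt μ f + b * sInt ν f := by
  lift a to NNReal using ha
  lift b to NNReal using hb
  obtain ⟨s, hs, hsf⟩ := exists_signedMeasure_sub
    (a • μ.toJordanDecomposition.posPart + b • ν.toJordanDecomposition.posPart)
    (a • μ.toJordanDecomposition.negPart + b • ν.toJordanDecomposition.negPart)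
  refine ⟨s, hs.trans_eq ?_, fun f => ?_⟩
  · rw [tvNorm_eq, tvNorm_eq]
    rw [measureReal_add_apply, measureReal_add_apply]
    simp only [measureReal_nnreal_smul_apply]
    ring
  · rw [hsf, integral_add_measure (f.integrable _) (f.integrable _),
      integral_add_measure (f.integrable _) (f.integrable _)]
    simp only [integral_smul_nnreal_measure, sInt, NNReal.smul_def, smul_eq_mul]
    ring

lemma exists_signedMeasure_dirac (θ : Θ) :
    ∃ s : SignedMeasure Θ, tvNorm s ≤ 1 ∧ ∀ f : C₀(Θ, ℝ), sInt s f = f θ := by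
  obtain ⟨s, hs, hsf⟩ := exists_signedMeasure_sub (Measure.dirac θ) 0
  refine ⟨s, by simpa using hs, fun f => ?_⟩
  rw [hsf, integral_dirac' _ _ (map_continuous f).stronglyMeasurable]
  simp

lemma exists_signedMeasure_neg_dirac (θ : Θ) :
    ∃ s : SignedMeasure Θ, tvNorm s ≤ 1 ∧ ∀ f : C₀(Θ, ℝ), sInt s f = -f θ := by
  obtain ⟨s, hs, hsf⟩ := exists_signedMeasure_sub 0 (Measure.dirac θ)
  refine ⟨s, by simpa using hs, fun f => ?_⟩
  rw [hsf, integral_dirac' _ _ (map_continuous f).stronglyMeasurable]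
  simp

/-- The extension of a function vanishing at infinity to the one-point compactification. -/
def onePointExtension {X : Type*} [TopologicalSpace X] [T2Space X] (f : C₀(X, ℝ)) : C(OnePoint X, ℝ) where
  toFun x := x.elim 0 f
  continuous_toFun := by
    refine (OnePoint.continuous_iff _).2 ⟨?_, f.continuous⟩
    exact Filter.coclosedCompact_eq_cocompact (X := X) ▸ f.zero_at_infty'

variable {α β : Type*}

/-- The function `a b ↦ ∫ K a b dμ` represented by a signed measure `μ`. -/
def represented (K : α → β → C₀(Θ, ℝ)) (μ : SignedMeasure Θ) : α → β → ℝ :=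
  fun a b => sInt μ (K a b)

/-- The smallest total variation of a signed measure representing `f`. -/
def representedNorm (K : α → β → C₀(Θ, ℝ)) (f : α → β → ℝ) : ℝ :=
  sInf (tvNorm '' {ν : SignedMeasure Θ | represented K ν = f})

/-- The functions represented by signed measures of total variation at most one. -/
def representedBall (K : α → β → C₀(Θ, ℝ)) : Set (α → β → ℝ) :=
  {f | ∃ μ : SignedMeasure Θ, tvNorm μ ≤ 1 ∧ represented K μ = f}

lemma convex_representedBall (K : α → β → C₀(Θ, ℝ)) : Convex ℝ (representedBall K) := by
  rintro _ ⟨μ, hμ, rfl⟩ _ ⟨ν, hν, rfl⟩ s t hs ht hst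
  obtain ⟨τ, hτ, hτf⟩ := exists_signedMeasure_combination μ ν hs ht
  refine ⟨τ, ?_, ?_⟩
  · nlinarith
  · ext a b
    simp [represented, hτf]

lemma isCompact_representedBall [T2Space Θ] [LocallyCompactSpace Θ] (K : α → β → C₀(Θ, ℝ)) :
    IsCompact (representedBall K) := by
  let : MeasurableSpace (OnePoint Θ) := borel (OnePoint Θ)
  have : BorelSpace (OnePoint Θ) := ⟨rfl⟩
  have hemb : MeasurableEmbedding ((↑) : Θ → OnePoint Θ) :=
    OnePoint.isOpenEmbedding_coe.measurableEmbedding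
  let Ω := FiniteMeasure (OnePoint Θ)
  let S : Set (Ω × Ω) := ({μ | μ.mass ≤ 1} ×ˢ {μ | μ.mass ≤ 1}) ∩ {q | q.1.mass + q.2.mass ≤ 1}
  have hS : IsCompact S :=
    ((isCompact_setOfPred_finiteMeasure_le_of_compactSpace _ 1).prod
      (isCompact_setOfPred_finiteMeasure_le_of_compactSpace _ 1)).inter_right
      (isClosed_le (by fun_prop) continuous_const)
  let Φ : Ω × Ω → α → β → ℝ := fun q a b =>
    (∫ x, onePointExtension (K a b) x ∂(q.1 : Measure (OnePoint Θ)))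
      - ∫ x, onePointExtension (K a b) x ∂(q.2 : Measure (OnePoint Θ))
  have hΦ : Continuous Φ := by
    refine continuous_pi fun a => continuous_pi fun b => ?_
    have h := FiniteMeasure.continuous_integral_boundedContinuousFunction
      (BoundedContinuousFunction.mkOfCompact (onePointExtension (K a b)))
    exact (h.comp continuous_fst).sub (h.comp continuous_snd)
  convert hS.image hΦ using 1
  ext f
  constructor
  · rintro ⟨μ, hμ, rfl⟩
    let p : FiniteMeasure Θ := ⟨μ.toJordanDecomposition.posPart, inferInstance⟩
    let n : FiniteMeasure Θ := ⟨μ.toJordanDecomposition.negPart, inferInstance⟩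
    have hmass : p.mass + n.mass ≤ 1 := by
      rw [tvNorm_eq] at hμ
      exact_mod_cast hμ
    have hpm := p.mass_map_le ((↑) : Θ → OnePoint Θ)
    have hnm := n.mass_map_le ((↑) : Θ → OnePoint Θ)
    refine ⟨(p.map (↑), n.map (↑)), ⟨⟨?_, ?_⟩, ?_⟩, ?_⟩
    · exact (hpm.trans (le_add_of_nonneg_right zero_le)).trans hmass
    · exact (hnm.trans (le_add_of_nonneg_left zero_le)).trans hmass
    · exact (add_le_add hpm hnm).trans hmass
    · ext a b
      simp only [represented, Φ, FiniteMeasure.toMeasure_map, hemb.integral_map]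
      rfl
  · rintro ⟨⟨p, n⟩, ⟨-, hpn⟩, rfl⟩
    obtain ⟨s, hs, hsf⟩ := exists_signedMeasure_sub
      (Measure.comap ((↑) : Θ → OnePoint Θ) (p : Measure (OnePoint Θ)))
      (Measure.comap ((↑) : Θ → OnePoint Θ) (n : Measure (OnePoint Θ)))
    have hint : ∀ (q : Measure (OnePoint Θ)) (g : C₀(Θ, ℝ)),
        ∫ θ, g θ ∂(Measure.comap ((↑) : Θ → OnePoint Θ) q) = ∫ x, onePointExtension g x ∂q := by
      intro q g
      have h1 := hemb.integral_map (μ := Measure.comap ((↑) : Θ → OnePoint Θ) q)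
        (onePointExtension g)
      rw [hemb.map_comap] at h1
      refine h1.symm.trans (setIntegral_eq_integral_of_forall_compl_eq_zero fun x hx => ?_)
      induction x using OnePoint.rec with
      | infty => rfl
      | coe x => exact absurd ⟨x, rfl⟩ hx
    have hcm : ∀ q : Ω, (Measure.comap ((↑) : Θ → OnePoint Θ) (q : Measure (OnePoint Θ))).real
        Set.univ ≤ q.mass := by
      intro q
      exact_mod_cast q.mass_comap_le ((↑) : Θ → OnePoint Θ)
    refine ⟨s, hs.trans ((add_le_add (hcm p) (hcm n)).trans ?_), ?_⟩
    · exact_mod_cast hpn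
    · ext a b
      simp only [represented, hsf, Φ, hint]

omit [BorelSpace Θ] in
lemma representedNorm_le (K : α → β → C₀(Θ, ℝ)) {μ : SignedMeasure Θ} {f : α → β → ℝ}
    (h : represented K μ = f) : representedNorm K f ≤ tvNorm μ :=
  csInf_le ⟨0, by rintro _ ⟨ν, -, rfl⟩; exact tvNorm_nonneg ν⟩ ⟨μ, h, rfl⟩

omit [BorelSpace Θ] in
lemma le_representedNorm (K : α → β → C₀(Θ, ℝ)) {f : α → β → ℝ} {r : ℝ}
    (hf : f ∈ Set.range (represented K)) (h : ∀ μ, represented K μ = f → r ≤ tvNorm μ) :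
    r ≤ representedNorm K f := by
  obtain ⟨μ, hμ⟩ := hf
  refine le_csInf ⟨_, μ, hμ, rfl⟩ ?_
  rintro _ ⟨ν, hν, rfl⟩
  exact h ν hν

lemma exists_represented_eq_smul (K : α → β → C₀(Θ, ℝ)) {f : α → β → ℝ} {μ : SignedMeasure Θ}
    (h : represented K μ = f) {r : ℝ} (hr : 0 ≤ r) :
    ∃ ν, tvNorm ν ≤ r * tvNorm μ ∧ represented K ν = r • f := by
  obtain ⟨ν, hν, hνf⟩ := exists_signedMeasure_combination μ μ hr le_rfl
  refine ⟨ν, by simpa using hν, ?_⟩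
  ext a b
  simp [represented, hνf, ← h]

lemma exists_represented_eq_smul_of_mem_ball (K : α → β → C₀(Θ, ℝ)) {f : α → β → ℝ}
    (hf : f ∈ representedBall K) {r : ℝ} (hr : 0 ≤ r) :
    ∃ ν, tvNorm ν ≤ r ∧ represented K ν = r • f := by
  obtain ⟨μ, hμ, h⟩ := hf
  obtain ⟨ν, hν, hνf⟩ := exists_represented_eq_smul K h hr
  exact ⟨ν, hν.trans (mul_le_of_le_one_right hr hμ), hνf⟩

lemma inv_smul_mem_representedBall (K : α → β → C₀(Θ, ℝ)) {f : α → β → ℝ} {μ : SignedMeasure Θ}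
    (h : represented K μ = f) {r : ℝ} (hr : 0 < r) (hμ : tvNorm μ ≤ r) :
    r⁻¹ • f ∈ representedBall K := by
  obtain ⟨ν, hν, hνf⟩ := exists_represented_eq_smul K h (inv_nonneg.2 hr.le)
  refine ⟨ν, hν.trans ?_, hνf⟩
  rw [inv_mul_le_iff₀ hr, mul_one]
  exact hμ

lemma zero_mem_representedBall (K : α → β → C₀(Θ, ℝ)) : (0 : α → β → ℝ) ∈ representedBall K := by
  obtain ⟨s, hs, hsf⟩ := exists_signedMeasure_sub (0 : Measure Θ) 0
  refine ⟨s, hs.trans (by simp), ?_⟩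
  ext a b
  simp [represented, hsf]

/-- The infimum in the definition of the norm is attained for functions of norm one. -/
lemma mem_representedBall_of_representedNorm_eq_one [T2Space Θ] [LocallyCompactSpace Θ]
    (K : α → β → C₀(Θ, ℝ)) {f : α → β → ℝ} (hf : f ∈ Set.range (represented K))
    (h1 : representedNorm K f = 1) : f ∈ representedBall K := by
  have hmem : ∀ r : ℝ, 1 < r → r⁻¹ • f ∈ representedBall K := by
    intro r hr
    obtain ⟨μ₀, hμ₀⟩ := hf
    obtain ⟨_, ⟨μ, hμ, rfl⟩, hlt⟩ :=
      exists_lt_of_csInf_lt (Set.Nonempty.image tvNorm ⟨μ₀, hμ₀⟩)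
        (show representedNorm K f < r by rwa [h1])
    exact inv_smul_mem_representedBall K hμ (by linarith) hlt.le
  have hcont : ContinuousAt (fun r : ℝ => r⁻¹ • f) 1 :=
    (continuousAt_inv₀ one_ne_zero).smul continuousAt_const
  have hlim : Tendsto (fun r : ℝ => r⁻¹ • f) (𝓝[>] 1) (𝓝 f) := by
    have := hcont.tendsto.mono_left (nhdsWithin_le_nhds (s := Set.Ioi 1))
    rwa [inv_one, one_smul] at this
  exact (isCompact_representedBall K).isClosed.mem_of_tendsto hlim
    (eventually_nhdsWithin_of_forall hmem)

/-- Existence of a minimizer of a lower semicontinuous loss regularized by the norm. -/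
lemma exists_regularized_minimizer [T2Space Θ] [LocallyCompactSpace Θ]
    (K : α → β → C₀(Θ, ℝ)) {q : (α → β → ℝ) → ℝ} (hq0 : ∀ f, 0 ≤ q f)
    (hq : LowerSemicontinuous q) {lam : ℝ} (hlam : 0 < lam) :
    ∃ f ∈ Set.range (represented K), ∀ μ,
      q f + lam * representedNorm K f
        ≤ q (represented K μ) + lam * representedNorm K (represented K μ) := by
  set R := q 0 / lam
  have hR : 0 ≤ R := div_nonneg (hq0 0) hlam.le
  have hlsc : LowerSemicontinuous fun p : ℝ × (α → β → ℝ) => q (p.1 • p.2) + lam * p.1 :=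
    (hq.comp (continuous_fst.smul continuous_snd)).add
      (continuous_const.mul continuous_fst).lowerSemicontinuous
  obtain ⟨⟨r, b⟩, ⟨hr, hb⟩, hmin⟩ := (hlsc.lowerSemicontinuousOn _).exists_isMinOn
    (s := Set.Icc 0 R ×ˢ representedBall K)
    ⟨(0, 0), ⟨le_rfl, hR⟩, zero_mem_representedBall K⟩
    (isCompact_Icc.prod (isCompact_representedBall K))
  have hle : ∀ s ∈ Set.Icc 0 R, ∀ b' ∈ representedBall K,
      q (r • b) + lam * r ≤ q (s • b') + lam * s :=
    fun s hs b' hb' => hmin (show (s, b') ∈ Set.Icc 0 R ×ˢ representedBall K from ⟨hs, hb'⟩)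
  have hmeas : ∀ ν, q (r • b) + lam * r ≤ q (represented K ν) + lam * tvNorm ν := by
    intro ν
    rcases le_or_gt (tvNorm ν) R with hν | hν
    · rcases (tvNorm_nonneg ν).eq_or_lt with h0 | h0
      · have hrep : represented K ν = 0 := by
          ext a b
          have := abs_sInt_le ν (K a b)
          rw [← h0, zero_mul] at this
          exact abs_nonpos_iff.1 this
        have := hle 0 ⟨le_rfl, hR⟩ 0 (zero_mem_representedBall K)
        rw [hrep, ← h0]
        rwa [zero_smul] at this
      · have := hle _ ⟨h0.le, hν⟩ _ (inv_smul_mem_representedBall K rfl h0 le_rfl)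
        rwa [smul_inv_smul₀ h0.ne'] at this
    · have h1 := hle 0 ⟨le_rfl, hR⟩ 0 (zero_mem_representedBall K)
      rw [zero_smul, mul_zero, add_zero] at h1
      have h2 : q 0 = lam * R := (mul_div_cancel₀ _ hlam.ne').symm
      have h3 := mul_le_mul_of_nonneg_left hν.le hlam.le
      linarith [hq0 (represented K ν)]
  obtain ⟨τ, hτ, hτf⟩ := exists_represented_eq_smul_of_mem_ball K hb hr.1
  refine ⟨r • b, ⟨τ, hτf⟩, fun μ => ?_⟩
  have h1 : representedNorm K (r • b) ≤ r := (representedNorm_le K hτf).trans hτ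
  have h2 : (q (r • b) + lam * r - q (represented K μ)) / lam
      ≤ representedNorm K (represented K μ) := by
    refine le_representedNorm K ⟨μ, rfl⟩ fun ν hν => ?_
    rw [div_le_iff₀ hlam]
    have := hmeas ν
    rw [hν] at this
    linarith
  rw [div_le_iff₀ hlam] at h2
  linarith [mul_le_mul_of_nonneg_left h1 hlam.le]

variable {κ ι : Type*} [Fintype κ] [Fintype ι]

/-- Sampling a function at the points `x j`. -/
def sampling (κ : Type*) (x : ι → α) : (α → κ → ℝ) →L[ℝ] (κ → ι → ℝ) where
  toFun f k j := f (x j) k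
  map_add' _ _ := rfl
  map_smul' _ _ := rfl
  cont := by fun_prop

/-- The linear functional on data with coefficients `c`. -/
def dataFunctional (c : κ × ι → ℝ) : (κ → ι → ℝ) →L[ℝ] ℝ where
  toFun z := ∑ p, c p * z p.1 p.2
  map_add' _ _ := by simp [mul_add, Finset.sum_add_distrib]
  map_smul' r z := by simp [Finset.mul_sum, mul_left_comm]
  cont := by fun_prop

lemma exists_dataFunctional_eq (ℓ : (κ → ι → ℝ) →L[ℝ] ℝ) :
    ∃ c : κ × ι → ℝ, dataFunctional c = ℓ := by
  classical
  refine ⟨fun p => ℓ (Pi.single p.1 (Pi.single p.2 1)), ?_⟩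
  ext z
  have hz : z = ∑ p : κ × ι, z p.1 p.2 • Pi.single p.1 (Pi.single p.2 1) := by
    ext k j
    simp [Fintype.sum_prod_type, Finset.sum_apply, Pi.single_apply, ite_apply]
  conv_rhs => rw [hz]
  simp [dataFunctional, mul_comm]

lemma dataFunctional_sampling_represented (K : α → κ → C₀(Θ, ℝ)) (x : ι → α) (c : κ × ι → ℝ)
    (μ : SignedMeasure Θ) :
    dataFunctional c (sampling κ x (represented K μ))
      = sInt μ (∑ p, c p • K (x p.2) p.1 : C₀(Θ, ℝ)) := by
  have : sInt μ (∑ p, c p • K (x p.2) p.1 : C₀(Θ, ℝ))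
      = sIntLinear μ (∑ p, c p • K (x p.2) p.1) := rfl
  rw [this, map_sum]
  simp only [map_smul]
  rfl

/-- Data dominated on the span of the sampled kernels by `n ‖·‖` is attained at norm `n`. -/
lemma exists_mem_representedBall_sampling_eq [T2Space Θ] [LocallyCompactSpace Θ]
    (K : α → κ → C₀(Θ, ℝ)) (x : ι → α) {z : κ → ι → ℝ} {n : ℝ} (hn : 0 < n)
    (hz : ∀ c : κ × ι → ℝ, dataFunctional c z ≤ n * ‖∑ p, c p • K (x p.2) p.1‖) :
    ∃ b ∈ representedBall K, sampling κ x (n • b) = z := by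
  by_contra hcon
  let C : Set (κ → ι → ℝ) := (n • sampling κ x) '' representedBall K
  have hCz : z ∉ C := by
    rintro ⟨b, hb, hbz⟩
    exact hcon ⟨b, hb, by rw [map_smul]; exact hbz⟩
  have hCconv : Convex ℝ C :=
    (convex_representedBall K).linear_image (n • sampling κ x).toLinearMap
  have hCclosed : IsClosed C :=
    ((isCompact_representedBall K).image (n • sampling κ x).continuous).isClosed
  obtain ⟨ℓ, u, hu, huz⟩ := geometric_hahn_banach_closed_point hCconv hCclosed hCz
  obtain ⟨c, rfl⟩ := exists_dataFunctional_eq ℓ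
  have hball : ∀ μ : SignedMeasure Θ, tvNorm μ ≤ 1 →
      n * sInt μ (∑ p, c p • K (x p.2) p.1 : C₀(Θ, ℝ)) < u := by
    intro μ hμ
    rw [← dataFunctional_sampling_represented, ← smul_eq_mul, ← map_smul]
    exact hu _ ⟨_, ⟨μ, hμ, rfl⟩, rfl⟩
  have hu0 : 0 < u := by
    have := hu _ ⟨0, zero_mem_representedBall K, rfl⟩
    simpa using this
  have hnorm : ‖∑ p, c p • K (x p.2) p.1‖ ≤ u / n := by
    refine ZeroAtInftyContinuousMap.norm_le_of_abs_apply_le _ (div_nonneg hu0.le hn.le)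
      fun θ => ?_
    rw [le_div_iff₀' hn, ← abs_of_pos hn, ← abs_mul, abs_le']
    obtain ⟨s, hs, hsf⟩ := exists_signedMeasure_dirac θ
    obtain ⟨s', hs', hsf'⟩ := exists_signedMeasure_neg_dirac θ
    have h1 := hball s hs
    have h2 := hball s' hs'
    rw [hsf] at h1
    rw [hsf', mul_neg] at h2
    exact ⟨h1.le, h2.le⟩
  rw [le_div_iff₀' hn] at hnorm
  linarith [hz c]

/-- A linear functional on a finite-dimensional normed space attains its norm. -/
lemma exists_norming_vector {V : Type*} [NormedAddCommGroup V] [NormedSpace ℝ V]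
    [FiniteDimensional ℝ V] (Z : V →ₗ[ℝ] ℝ) :
    ∃ g : V, ‖g‖ ≤ 1 ∧ ∀ v, Z v ≤ Z g * ‖v‖ := by
  have : ProperSpace V := FiniteDimensional.proper_real V
  obtain ⟨g, hg, hmax⟩ := (isCompact_closedBall (0 : V) 1).exists_isMaxOn
    ⟨0, by simp⟩ Z.continuous_of_finiteDimensional.continuousOn
  refine ⟨g, mem_closedBall_zero_iff.1 hg, fun v => ?_⟩
  rcases (norm_nonneg v).eq_or_lt with hv | hv
  · rw [norm_eq_zero.1 hv.symm]
    simp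
  · have : Z (‖v‖⁻¹ • v) ≤ Z g := hmax (mem_closedBall_zero_iff.2 (by
      rw [norm_smul, norm_inv, norm_norm, inv_mul_cancel₀ hv.ne']))
    rwa [map_smul, smul_eq_mul, inv_mul_le_iff₀ hv, mul_comm] at this

/-- A linear functional nonvanishing on a finite-dimensional subspace attains its norm on the
unit sphere of that subspace. -/
lemma exists_norming_mem {E : Type*} [NormedAddCommGroup E] [NormedSpace ℝ E]
    (V : Submodule ℝ E) [FiniteDimensional ℝ V] (Z : E →ₗ[ℝ] ℝ) (hZ : ∃ v ∈ V, Z v ≠ 0) :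
    ∃ g ∈ V, ‖g‖ = 1 ∧ 0 < Z g ∧ ∀ v ∈ V, Z v ≤ Z g * ‖v‖ := by
  obtain ⟨g, hg, hmax⟩ := exists_norming_vector (Z.comp V.subtype)
  replace hmax : ∀ v ∈ V, Z v ≤ Z g * ‖v‖ := fun v hv => hmax ⟨v, hv⟩
  have hpos : 0 < Z g := by
    obtain ⟨v, hvV, hv⟩ := hZ
    have h1 := hmax v hvV
    have h2 := hmax (-v) (V.neg_mem hvV)
    rw [map_neg, norm_neg] at h2
    by_contra! hle
    have := mul_nonpos_of_nonpos_of_nonneg hle (norm_nonneg v)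
    exact hv (by linarith)
  exact ⟨g, g.2, le_antisymm hg ((le_mul_iff_one_le_right hpos).1 (hmax g g.2)), hpos, hmax⟩

/-- A norming element of the span of the sampled kernels for nonzero data. -/
lemma exists_dual_certificate [T2Space Θ] [LocallyCompactSpace Θ]
    (K : α → κ → C₀(Θ, ℝ)) (x : ι → α) {f₀ : α → κ → ℝ}
    (hf₀ : f₀ ∈ Set.range (represented K)) (h0 : sampling κ x f₀ ≠ 0) :
    ∃ (c : κ × ι → ℝ) (g : C₀(Θ, ℝ)), g = ∑ p, c p • K (x p.2) p.1 ∧ g ≠ 0 ∧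
      ‖g‖ ≤ representedNorm K f₀ ∧
      ∃ b ∈ representedBall K, sampling κ x (‖g‖ • b) = sampling κ x f₀ ∧
        dataFunctional c (sampling κ x b) = ‖g‖ := by
  obtain ⟨μ₀, rfl⟩ := hf₀
  have : FiniteDimensional ℝ
      (Submodule.span ℝ (Set.range fun p : κ × ι => K (x p.2) p.1)) :=
    FiniteDimensional.span_of_finite ℝ (Set.finite_range _)
  obtain ⟨g₁, hg₁, hg₁n, hnpos, hZn⟩ := exists_norming_mem
    (Submodule.span ℝ (Set.range fun p : κ × ι => K (x p.2) p.1)) (sIntLinear μ₀) (by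
      obtain ⟨k, hk⟩ := Function.ne_iff.1 h0
      obtain ⟨j, hj⟩ := Function.ne_iff.1 hk
      exact ⟨K (x j) k, Submodule.subset_span ⟨(k, j), rfl⟩, hj⟩)
  set n := sIntLinear μ₀ g₁ with hn
  obtain ⟨c, hc⟩ := (Submodule.mem_span_range_iff_exists_fun ℝ).1 (Submodule.smul_mem _ n hg₁)
  have hgn : ‖n • g₁‖ = n := by
    rw [norm_smul, hg₁n, Real.norm_of_nonneg hnpos.le, mul_one]
  have hval : dataFunctional c (sampling κ x (represented K μ₀)) = n * n := by
    rw [dataFunctional_sampling_represented, hc]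
    change sIntLinear μ₀ (n • g₁) = _
    rw [map_smul, smul_eq_mul, ← hn]
  obtain ⟨b, hb, hbz⟩ := exists_mem_representedBall_sampling_eq K x hnpos
    (z := sampling κ x (represented K μ₀)) fun d => by
      rw [dataFunctional_sampling_represented]
      exact hZn _ (Submodule.sum_mem _ fun p _ =>
        Submodule.smul_mem _ _ (Submodule.subset_span ⟨p, rfl⟩))
  refine ⟨c, _, hc.symm, ?_, ?_, b, hb, ?_, ?_⟩
  · rw [← norm_pos_iff, hgn]
    exact hnpos
  · rw [hgn]
    refine le_representedNorm K ⟨μ₀, rfl⟩ fun ν hν => ?_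
    have h1 := (le_abs_self _).trans (abs_sInt_le ν (∑ p, c p • K (x p.2) p.1))
    rw [← dataFunctional_sampling_represented, hν, hval, hc, hgn] at h1
    exact le_of_mul_le_mul_right h1 hnpos
  · rw [hgn, hbz]
  · rw [hgn]
    rw [← hbz, map_smul, map_smul, smul_eq_mul] at hval
    exact mul_left_cancel₀ hnpos.ne' hval

/-- The subdifferential of the supremum norm at a combination of sampled kernels. -/
lemma subdifferential_eq [T2Space Θ] [LocallyCompactSpace Θ]
    (K : α → κ → C₀(Θ, ℝ)) (x : ι → α) (c : κ × ι → ℝ) {g : C₀(Θ, ℝ)}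
    (hg : g = ∑ p, c p • K (x p.2) p.1) (hg0 : g ≠ 0) :
    {f | f ∈ Set.range (represented K) ∧ representedNorm K f = 1 ∧
        ∀ μ, represented K μ = f → sInt μ g = ‖g‖}
      = representedBall K ∩ {f | dataFunctional c (sampling κ x f) = ‖g‖} := by
  have hpair : ∀ μ, dataFunctional c (sampling κ x (represented K μ)) = sInt μ g := by
    intro μ
    rw [dataFunctional_sampling_represented, hg]
  ext f
  constructor
  · rintro ⟨hf, h1, hfg⟩
    refine ⟨mem_representedBall_of_representedNorm_eq_one K hf h1, ?_⟩
    obtain ⟨μ, rfl⟩ := hf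
    exact (hpair μ).trans (hfg μ rfl)
  · rintro ⟨⟨μ, hμ, rfl⟩, hfg⟩
    have hall : ∀ ν, represented K ν = represented K μ → sInt ν g = ‖g‖ := by
      intro ν hν
      rw [← hpair, hν]
      exact hfg
    refine ⟨⟨μ, rfl⟩, le_antisymm ((representedNorm_le K rfl).trans hμ)
      (le_representedNorm K ⟨μ, rfl⟩ fun ν hν => ?_), hall⟩
    have h1 := (le_abs_self _).trans (abs_sInt_le ν g)
    rw [hall ν hν] at h1
    exact (le_mul_iff_one_le_left (norm_pos_iff.2 hg0)).1 h1

/-- Representer theorem: data of a represented function can be matched, without increasing the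
norm, by a combination of extreme points of a subdifferential. -/
lemma exists_representer [T2Space Θ] [LocallyCompactSpace Θ]
    (K : α → κ → C₀(Θ, ℝ)) (x : ι → α) {f₀ : α → κ → ℝ}
    (hf₀ : f₀ ∈ Set.range (represented K)) (h0 : sampling κ x f₀ ≠ 0) {N : ℕ}
    (hN : Module.finrank ℝ (κ → ι → ℝ) ≤ N) :
    ∃ f ∈ Set.range (represented K), sampling κ x f = sampling κ x f₀ ∧
      representedNorm K f ≤ representedNorm K f₀ ∧ ∃ g : C₀(Θ, ℝ),
      g ∈ Submodule.span ℝ (Set.range fun p : κ × ι => K (x p.2) p.1) ∧ g ≠ 0 ∧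
      ∃ (γ : Fin N → ℝ) (h : Fin N → α → κ → ℝ), ∑ i, γ i = ‖g‖ ∧
        (∀ i, h i ∈ Set.extremePoints ℝ {f | f ∈ Set.range (represented K) ∧
          representedNorm K f = 1 ∧ ∀ μ, represented K μ = f → sInt μ g = ‖g‖}) ∧
        f = ∑ i, γ i • h i := by
  obtain ⟨c, g, hg, hg0, hgle, b, hb, hbz, hbg⟩ := exists_dual_certificate K x hf₀ h0
  rw [← hbz]
  have hgpos : 0 < ‖g‖ := norm_pos_iff.2 hg0
  set F := representedBall K ∩ {f | dataFunctional c (sampling κ x f) = ‖g‖} with hF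
  have hFc : IsCompact F := (isCompact_representedBall K).inter_right
    (isClosed_eq ((dataFunctional c).continuous.comp (sampling κ x).continuous)
      continuous_const)
  have hmem := mem_convexHull_extremePoints (φ := fun z : κ → ι → ℝ => ∑ k, ∑ j, z k j ^ 2)
    (by fun_prop) (strictConvexOn_sum_sum_sq κ ι) (hFc.image (sampling κ x).continuous)
    ⟨b, ⟨hb, hbg⟩, rfl⟩
  obtain ⟨w, p, hw, hp, hwp⟩ := exists_fin_of_mem_convexHull_of_subset_hyperplane hmem
    (dataFunctional c).toLinearMap hgpos.ne' (by
      intro y hy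
      obtain ⟨f, hf, rfl⟩ := hy.1
      exact hf.2) hN
  choose h hh hhp using fun i =>
    surjOn_extremePoints_image (sampling κ x).toContinuousAffineMap hFc (hp i)
  have hball : ∑ i, w i • h i ∈ representedBall K :=
    (convex_representedBall K).sum_mem (fun i _ => hw.1 i) hw.2 fun i _ => (hh i).1.1
  obtain ⟨τ, hτ, hτf⟩ := exists_represented_eq_smul_of_mem_ball K hball hgpos.le
  refine ⟨_, ⟨τ, hτf⟩, ?_, ((representedNorm_le K hτf).trans hτ).trans hgle, g, ?_, hg0,
    fun i => ‖g‖ * w i, h, ?_, ?_, ?_⟩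
  · rw [map_smul, map_smul, map_sum, ← hwp]
    congr 1
    refine Finset.sum_congr rfl fun i _ => ?_
    rw [map_smul, ← hhp]
    rfl
  · rw [hg]
    exact Submodule.sum_mem _ fun p _ =>
        Submodule.smul_mem _ _ (Submodule.subset_span ⟨p, rfl⟩)
  · rw [← Finset.mul_sum, hw.2, mul_one]
  · rw [subdifferential_eq K x c hg hg0]
    exact hh
  · simp only [Finset.smul_sum, smul_smul]

end SignedMeasures

/-- If `λ > 0`, the loss `Q` is lower semi-continuous and
`D_{X,Y} ≠ {0}`, then the regularization problem has a solution of the form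
`f̂ = ∑_{ℓ=1}^{tm} γ_ℓ h_ℓ` for some nonzero `ĝ ∈ V_N`, `∑ γ_ℓ = ‖ĝ‖_∞` and
`h_ℓ ∈ ext(∂‖·‖_∞(ĝ))`. -/
theorem statement_17
    (σ : ℝ → ℝ) (hσ : Continuous σ) (m : ℕ → ℕ) (D : ℕ) (hD : 0 < D)
    (ρ : Params m D → ℝ) (hρc : Continuous ρ) (hρpos : ∀ θ, 0 < ρ θ)
    (Kb : (Fin (m 0) → ℝ) → Fin (m D) → C₀(Params m D, ℝ))
    (hKb : ∀ x k θ, Kb x k θ = NNet σ m D θ x k * ρ θ)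
    (M : ℕ) (x : Fin M → (Fin (m 0) → ℝ)) (hx : Function.Injective x)
    (Y : Fin (m D) → Fin M → ℝ) (lam : ℝ) (hlam : 0 < lam)
    (Q : (Fin (m D) → Fin M → ℝ) → ℝ) (hQ0 : ∀ z, 0 ≤ Q z)
    (hQl : LowerSemicontinuous Q)
    (hDXY : DXY σ m D ρ M x Y lam Q ≠ {0}) :
    ∃ f ∈ RegSolSet σ m D ρ M x Y lam Q, ∃ g : C₀(Params m D, ℝ),
      g ∈ VN m D Kb M x ∧ g ≠ 0 ∧
      ∃ (γ : Fin (m D * M) → ℝ)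
        (h : Fin (m D * M) → ((Fin (m 0) → ℝ) → Fin (m D) → ℝ)),
        (∑ ℓ, γ ℓ) = ‖g‖
        ∧ (∀ ℓ, h ℓ ∈ Set.extremePoints ℝ (subdiffSup σ m D ρ g))
        ∧ ∀ (x' : Fin (m 0) → ℝ) (k : Fin (m D)), f x' k = ∑ ℓ, γ ℓ * h ℓ x' k := by
  have hrep : ∀ μ, fMu σ m D ρ μ = represented Kb μ := by
    intro μ
    ext a k
    exact congrArg (sInt μ) (funext fun θ => (hKb a k θ).symm)
  have hset : BNset σ m D ρ = Set.range (represented Kb) := by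
    ext f
    simp only [BNset, hrep, Set.mem_ofPred_eq, Set.mem_range]
  have hnorm : ∀ f, BNnorm σ m D ρ f = representedNorm Kb f := by
    intro f
    simp only [BNnorm, representedNorm, hrep]
  have hreg : ∀ f, regObj σ m D ρ M x Y lam Q f
      = Q (sampling (Fin (m D)) x f - Y) + lam * representedNorm Kb f := by
    intro f
    rw [regObj, hnorm]
    rfl
  have hsub : ∀ g, subdiffSup σ m D ρ g = {f | f ∈ Set.range (represented Kb) ∧
      representedNorm Kb f = 1 ∧ ∀ μ, represented Kb μ = f → sInt μ g = ‖g‖} := by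
    intro g
    simp only [subdiffSup, hset, hnorm, hrep]
  have hmem : ∀ f, f ∈ RegSolSet σ m D ρ M x Y lam Q ↔ f ∈ Set.range (represented Kb) ∧
      ∀ μ, Q (sampling (Fin (m D)) x f - Y) + lam * representedNorm Kb f
        ≤ Q (sampling (Fin (m D)) x (represented Kb μ) - Y)
          + lam * representedNorm Kb (represented Kb μ) := by
    intro f
    simp only [RegSolSet, hset, hreg, hrep, Set.mem_ofPred_eq]
  obtain ⟨f₁, hf₁, hf₁min⟩ := exists_regularized_minimizer Kb
    (q := fun f => Q (sampling (Fin (m D)) x f - Y)) (fun f => hQ0 _)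
    (hQl.comp ((sampling (Fin (m D)) x).continuous.sub continuous_const)) hlam
  have hne : (DXY σ m D ρ M x Y lam Q).Nonempty := ⟨_, f₁, (hmem f₁).2 ⟨hf₁, hf₁min⟩, rfl⟩
  obtain ⟨f₀, hf₀, hf₀z⟩ : ∃ f₀ ∈ RegSolSet σ m D ρ M x Y lam Q,
      sampling (Fin (m D)) x f₀ ≠ 0 := by
    by_contra! hall
    refine hDXY (hne.subset_singleton_iff.1 ?_)
    rintro _ ⟨f, hf, rfl⟩
    exact hall f hf
  obtain ⟨hf₀r, hf₀min⟩ := (hmem f₀).1 hf₀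
  obtain ⟨f, hf, hfz, hfn, g, hgV, hg0, γ, h, hγ, hh, hfsum⟩ :=
    exists_representer Kb x hf₀r hf₀z (N := m D * M)
      (by simp [Module.finrank_pi_fintype])
  refine ⟨f, (hmem f).2 ⟨hf, fun μ => le_trans ?_ (hf₀min μ)⟩, g, hgV, hg0, γ, h, hγ,
    fun ℓ => ?_, fun x' k => ?_⟩
  · rw [hfz]
    gcongr
  · rw [hsub]
    exact hh ℓ
  · simp [hfsum]

end
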